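/- Let 1 ≤ p ≤ ∞ and 1 ≤ q < ∞. The polynomials are dense in RM(p,q); in particular RM(p,q) is separable. -/

import Mathlib

open MeasureTheory Complex Real ENNReal

/-- Radial `L^p` average `( ∫₀¹ |f(r e^{iθ})|^p dr )^{1/p}` (sup over `r` if `p = ∞`),
valued in `ℝ≥0∞`. -/
noncomputable def radialLp (p : ℝ≥0∞) (f : ℂ → ℂ) (θ : ℝ) : ℝ≥0∞ :=
  if p = ⊤ then
    ⨆ r : Set.Ico (0 : ℝ) 1,
      ENNReal.ofReal ‖f ((r : ℝ) * Complex.exp ((θ : ℂ) * Complex.I))‖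
  else
    (∫⁻ r in Set.Ioo (0:ℝ) 1,
        ENNReal.ofReal
          (‖f ((r : ℝ) * Complex.exp ((θ : ℂ) * Complex.I))‖ ^ p.toReal)) ^ (1 / p.toReal)

/-- The mixed norm `ρ_{p,q}(f)`, valued in `ℝ≥0∞`; for `q < ∞` it is
`((1/2π) ∫₀^{2π} (radial L^p average)^q dθ)^{1/q}`, and for `q = ∞` the essential/radial sup. -/
noncomputable def rhoE (p q : ℝ≥0∞) (f : ℂ → ℂ) : ℝ≥0∞ :=
  if q = ⊤ then ⨆ θ : Set.Ico (0 : ℝ) (2 * Real.pi), radialLp p f (θ : ℝ)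
  else
    ((ENNReal.ofReal (2 * Real.pi))⁻¹ *
        ∫⁻ θ in Set.Ioo (0 : ℝ) (2 * Real.pi), (radialLp p f θ) ^ q.toReal) ^ (1 / q.toReal)

section Helpers

open Filter Topology Metric

/-- The difference kernel. -/
noncomputable def kerK (ζ₀ : ℂ) (r : ℝ) (ζ : ℂ) : ℂ :=
  ((ζ - r * ζ₀) ^ 2)⁻¹ - ((ζ - ζ₀ / r) ^ 2)⁻¹

lemma refl_norm {ζ₀ ζ : ℂ} (h0 : ‖ζ₀‖ = 1) (h : ‖ζ‖ = 1) {r : ℝ} (hr : 0 < r) :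
    ‖ζ - ζ₀ / r‖ = ‖ζ - r * ζ₀‖ / r := by
  have e : ‖(r:ℂ) * ζ - ζ₀‖ = ‖ζ - r * ζ₀‖ := by
    have h1 : ‖(r:ℂ) * ζ - ζ₀‖ ^ 2 = ‖ζ - r * ζ₀‖ ^ 2 := by
      have a0 : ‖ζ₀‖ ^ 2 = 1 := by rw [h0]; norm_num
      have a1 : ‖ζ‖ ^ 2 = 1 := by rw [h]; norm_num
      rw [Complex.sq_norm, Complex.normSq_apply] at *
      rw [Complex.sq_norm, Complex.normSq_apply] at *
      simp at *
      linear_combination (r^2-1) * a1 - (r^2-1)*a0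
    exact (sq_eq_sq₀ (norm_nonneg _) (norm_nonneg _)).1 h1
  have hr' : (r:ℂ) ≠ 0 := by exact_mod_cast hr.ne'
  rw [← e, show ζ - ζ₀ / r = ((r:ℂ) * ζ - ζ₀) / r by field_simp, norm_div]
  simp [abs_of_pos hr]

lemma a_lower {ζ₀ ζ : ℂ} (h0 : ‖ζ₀‖ = 1) (h : ‖ζ‖ = 1) {r : ℝ} (hr : 0 < r) (hr1 : r < 1) :
    1 - r ≤ ‖ζ - r * ζ₀‖ := by
  have := norm_sub_norm_le ζ (r * ζ₀)
  rw [norm_mul, h, h0] at this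
  simpa [abs_of_pos hr] using this

lemma kerK_bound {ζ₀ ζ : ℂ} (h0 : ‖ζ₀‖ = 1) (h : ‖ζ‖ = 1) {r : ℝ} (hr : 0 < r) (hr1 : r < 1) :
    ‖kerK ζ₀ r ζ‖ * ‖ζ - r * ζ₀‖ ^ 3 ≤ 2 * (1 - r ^ 2) := by
  have hl := a_lower h0 h hr hr1
  have hb := refl_norm h0 h hr
  set a := ζ - r * ζ₀ with ha
  set b := ζ - ζ₀ / r with hbdef
  have hapos : 0 < ‖a‖ := by linarith
  have hbpos : 0 < ‖b‖ := by rw [hb]; positivity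
  have ha0 : a ≠ 0 := norm_pos_iff.1 hapos
  have hb0 : b ≠ 0 := norm_pos_iff.1 hbpos
  have hK : kerK ζ₀ r ζ = ((b - a) * (b + a)) / (a ^ 2 * b ^ 2) := by
    unfold kerK; rw [← ha, ← hbdef]; field_simp; ring
  have hba : ‖b - a‖ = (1 - r ^ 2) / r := by
    have hr' : (r:ℂ) ≠ 0 := by exact_mod_cast hr.ne'
    have : b - a = (((r ^ 2 - 1) / r : ℝ) : ℂ) * ζ₀ := by
      rw [ha, hbdef]; push_cast; field_simp; ring
    rw [this, norm_mul, h0, mul_one, Complex.norm_real, Real.norm_eq_abs, abs_div, abs_of_pos hr,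
      abs_of_nonpos (by nlinarith)]
    ring
  have hba' : ‖b + a‖ ≤ ‖a‖ / r + ‖a‖ := (norm_add_le _ _).trans (by rw [hb])
  rw [hK, norm_div, norm_mul, norm_mul, norm_pow, norm_pow, hba, hb]
  have : (1 - r ^ 2) / r * ‖b + a‖ / (‖a‖ ^ 2 * (‖a‖ / r) ^ 2) * ‖a‖ ^ 3
      = (1 - r ^ 2) * r * ‖b + a‖ / ‖a‖ := by
    field_simp
  rw [this, div_le_iff₀ hapos]
  have h2 : (1 - r ^ 2) * r * ‖b + a‖ ≤ (1 - r ^ 2) * r * (‖a‖ / r + ‖a‖) := by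
    apply mul_le_mul_of_nonneg_left hba'
    have : r ^ 2 ≤ 1 := by nlinarith
    nlinarith
  refine h2.trans ?_
  have : (1 - r ^ 2) * r * (‖a‖ / r + ‖a‖) = (1 - r ^ 2) * ((1 + r) * ‖a‖) := by field_simp
  rw [this]
  have : r ^ 2 ≤ 1 := by nlinarith
  nlinarith [mul_nonneg (sub_nonneg.2 this) hapos.le]

lemma kerK_bound1 {ζ₀ ζ : ℂ} (h0 : ‖ζ₀‖ = 1) (h : ‖ζ‖ = 1) {r : ℝ} (hr : 0 < r) (hr1 : r < 1) :
    ‖kerK ζ₀ r ζ‖ * ‖ζ - ζ₀‖ ≤ 4 * ((1 - r ^ 2) / ‖ζ - r * ζ₀‖ ^ 2) ∧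
    ‖kerK ζ₀ r ζ‖ * ‖ζ - ζ₀‖ ^ 3 ≤ 16 * (1 - r ^ 2) := by
  have hl := a_lower h0 h hr hr1
  have hk := kerK_bound h0 h hr hr1
  have hd : ‖ζ - ζ₀‖ ≤ 2 * ‖ζ - r * ζ₀‖ := by
    have : ζ - ζ₀ = (ζ - r * ζ₀) - ((1 - r : ℝ) : ℂ) * ζ₀ := by push_cast; ring
    rw [this]
    refine (norm_sub_le _ _).trans ?_
    rw [norm_mul, h0, Complex.norm_real, Real.norm_eq_abs, abs_of_pos (by linarith)]
    linarith
  set a := ‖ζ - r * ζ₀‖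
  have ha : 0 < a := by linarith
  constructor
  · rw [← mul_div_assoc, le_div_iff₀ (by positivity)]
    calc ‖kerK ζ₀ r ζ‖ * ‖ζ - ζ₀‖ * a ^ 2 ≤ ‖kerK ζ₀ r ζ‖ * (2 * a) * a ^ 2 := by gcongr
      _ = 2 * (‖kerK ζ₀ r ζ‖ * a ^ 3) := by ring
      _ ≤ _ := by linarith
  · calc ‖kerK ζ₀ r ζ‖ * ‖ζ - ζ₀‖ ^ 3 ≤ ‖kerK ζ₀ r ζ‖ * (2 * a) ^ 3 := by gcongr
      _ = 8 * (‖kerK ζ₀ r ζ‖ * a ^ 3) := by ring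
      _ ≤ _ := by linarith

lemma kerK_cont {ζ₀ : ℂ} (h0 : ‖ζ₀‖ = 1) {r : ℝ} (hr : 0 < r) (hr1 : r < 1) :
    ContinuousOn (kerK ζ₀ r) (sphere 0 1) := by
  unfold kerK
  have key : ∀ ζ ∈ sphere (0:ℂ) 1, ζ - r * ζ₀ ≠ 0 ∧ ζ - ζ₀ / r ≠ 0 := by
    intro ζ hζ
    have h : ‖ζ‖ = 1 := by simpa using hζ
    have hl := a_lower h0 h hr hr1
    have : 0 < ‖ζ - r * ζ₀‖ := by linarith
    refine ⟨norm_pos_iff.1 this, norm_pos_iff.1 ?_⟩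
    rw [refl_norm h0 h hr]; positivity
  refine ContinuousOn.sub (ContinuousOn.inv₀ (by fun_prop) fun ζ hζ => ?_)
    (ContinuousOn.inv₀ (by fun_prop) fun ζ hζ => ?_)
  · exact pow_ne_zero _ (key ζ hζ).1
  · exact pow_ne_zero _ (key ζ hζ).2

lemma kerK_repr {ζ₀ : ℂ} (h0 : ‖ζ₀‖ = 1) {r : ℝ} (hr : 0 < r) (hr1 : r < 1) {U : Set ℂ}
    (hU : IsOpen U) (hc : closedBall 0 1 ⊆ U) {G : ℂ → ℂ} (hG : DifferentiableOn ℂ G U) :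
    (2 * π * I : ℂ)⁻¹ • (∮ z in C(0, 1), kerK ζ₀ r z • G z) = deriv G (r * ζ₀) := by
  have hw : (r * ζ₀ : ℂ) ∈ ball (0:ℂ) 1 := by simp [h0, abs_of_pos hr, hr1]
  rw [← two_pi_I_inv_smul_circleIntegral_sub_sq_inv_smul_of_differentiable hU hc hG hw]
  congr 1
  have hGc : ContinuousOn G (closedBall 0 1) := hG.continuousOn.mono hc
  have hne : ∀ z ∈ closedBall (0:ℂ) 1, z - ζ₀ / r ≠ 0 := by
    intro z hz h
    have hz' : ‖z‖ ≤ 1 := by simpa using hz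
    rw [sub_eq_zero.1 h, norm_div, h0, Complex.norm_real, Real.norm_eq_abs, abs_of_pos hr,
      div_le_one hr] at hz'
    linarith
  have hz : (∮ z in C(0, 1), ((z - ζ₀ / r) ^ 2)⁻¹ • G z) = 0 := by
    apply circleIntegral_eq_zero_of_differentiable_on_off_countable zero_le_one Set.countable_empty
    · exact (ContinuousOn.inv₀ (by fun_prop) fun z hz => pow_ne_zero _ (hne z hz)).smul hGc
    · intro z hz
      have hz := ball_subset_closedBall hz.1
      have hd : DifferentiableAt ℂ (fun z : ℂ => (z - ζ₀ / r) ^ 2) z := by fun_prop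
      exact (hd.inv (pow_ne_zero _ (hne z hz))).smul
        (hG.differentiableAt (hU.mem_nhds (hc hz)))
  have hne1 : ∀ z ∈ sphere (0:ℂ) 1, z - r * ζ₀ ≠ 0 := by
    intro z hz
    have hl := a_lower h0 (by simpa using hz) hr hr1
    exact norm_pos_iff.1 (by linarith)
  have h1 : CircleIntegrable (fun z => ((z - r * ζ₀) ^ 2)⁻¹ • G z) 0 1 := by
    refine ContinuousOn.circleIntegrable zero_le_one ?_
    exact (ContinuousOn.inv₀ (by fun_prop) fun z hz => pow_ne_zero _ (hne1 z hz)).smul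
      (hGc.mono sphere_subset_closedBall)
  have h2 : CircleIntegrable (fun z => ((z - ζ₀ / r) ^ 2)⁻¹ • G z) 0 1 := by
    refine ContinuousOn.circleIntegrable zero_le_one ?_
    exact (ContinuousOn.inv₀ (by fun_prop) fun z hz =>
      pow_ne_zero _ (hne z (sphere_subset_closedBall hz))).smul
      (hGc.mono sphere_subset_closedBall)
  have hsub : (∮ z in C(0, 1), kerK ζ₀ r z • G z) = (∮ z in C(0, 1), ((z - r * ζ₀) ^ 2)⁻¹ • G z)
      - ∮ z in C(0, 1), ((z - ζ₀ / r) ^ 2)⁻¹ • G z := by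
    rw [← circleIntegral.integral_sub]
    · simp only [kerK, sub_smul]
    · exact h1
    · exact h2
  rw [hsub, hz, sub_zero]

lemma poisson_mass {ζ₀ : ℂ} (h0 : ‖ζ₀‖ = 1) {r : ℝ} (hr : 0 < r) (hr1 : r < 1) :
    ∫ θ in (0:ℝ)..2 * π, (1 - r ^ 2) / ‖Complex.exp (θ * I) - r * ζ₀‖ ^ 2 = 2 * π := by
  have hw : (r * ζ₀ : ℂ) ∈ ball (0:ℂ) 1 := by simp [h0, abs_of_pos hr, hr1]
  have hc1 : DiffContOnCl ℂ (fun _ : ℂ => (1:ℂ)) (ball 0 1) := diffContOnCl_const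
  have := hc1.circleAverage_poissonKernel_smul' hw
  rw [Real.circleAverage_def] at this
  simp only [circleMap, sub_zero, zero_add, norm_mul, h0, Complex.norm_real, one_smul, smul_eq_mul,
    Complex.ofReal_one, one_mul, norm_exp_ofReal_mul_I, Real.norm_eq_abs, abs_of_pos hr, mul_one,
    one_pow, Complex.real_smul, intervalIntegral.integral_ofReal] at this
  have h2 := congrArg (fun z : ℂ => z.re) this
  simp only [← Complex.ofReal_mul, Complex.ofReal_re, Complex.one_re] at h2
  have hpi := Real.pi_pos
  field_simp at h2
  linarith


lemma exp_bound {g : ℝ → ℂ} {θ₀ : ℝ} {g' : ℂ} (hθ : θ₀ ∈ Set.Ioo 0 (2 * π))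
    (hg : HasDerivAt g g' θ₀) {B : ℝ} (hB : ∀ θ ∈ Set.Icc 0 (2 * π), ‖g θ‖ ≤ B)
    {ε : ℝ} (hε : 0 < ε) :
    ∃ A : ℝ, 0 ≤ A ∧ ∀ θ ∈ Set.Icc 0 (2 * π),
      ‖g θ - g θ₀ - g' / (I * Complex.exp (θ₀ * I)) * (Complex.exp (θ * I) - Complex.exp (θ₀ * I))‖
        ≤ ε * ‖Complex.exp (θ * I) - Complex.exp (θ₀ * I)‖
          + A * ‖Complex.exp (θ * I) - Complex.exp (θ₀ * I)‖ ^ 3 := by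
  set c := g' / (I * Complex.exp (θ₀ * I)) with hc
  have he : HasDerivAt (fun θ : ℝ => Complex.exp (θ * I)) (I * Complex.exp (θ₀ * I)) θ₀ := by
    have h1 : HasDerivAt (fun θ : ℝ => (θ:ℂ) * I) (1 * I) θ₀ :=
      (Complex.ofRealCLM.hasDerivAt (x := θ₀)).mul_const I
    have := h1.cexp
    simpa [mul_comm] using this
  have hne : I * Complex.exp (θ₀ * I) ≠ 0 := mul_ne_zero I_ne_zero (Complex.exp_ne_zero _)
  have hh : HasDerivAt (fun θ : ℝ => g θ - c * Complex.exp (θ * I)) 0 θ₀ := by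
    have := hg.sub (he.const_mul c)
    rwa [hc, div_mul_cancel₀ _ hne, sub_self] at this
  have ho : (fun θ : ℝ => g θ - g θ₀ - c * (Complex.exp (θ * I) - Complex.exp (θ₀ * I)))
      =o[𝓝 θ₀] (fun θ => θ - θ₀) := by
    have := hh.isLittleO
    refine this.congr_left fun θ => ?_
    simp; ring
  have hO : (fun θ => θ - θ₀) =O[𝓝 θ₀]
      (fun θ : ℝ => Complex.exp (θ * I) - Complex.exp (θ₀ * I)) := 
    (he.isTheta_sub hne).2.comp_tendsto (tendsto_id.prodMk tendsto_const_pure)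
  have hev := (ho.trans_isBigO hO).def hε
  obtain ⟨η, hη, hnear⟩ := Metric.eventually_nhds_iff.1 hev
  -- far part
  have hinj : ∀ θ ∈ Set.Icc 0 (2 * π), Complex.exp (θ * I) = Complex.exp (θ₀ * I) → θ = θ₀ := by
    intro θ hθ' h
    obtain ⟨n, hn⟩ := Complex.exp_eq_exp_iff_exists_int.1 h
    have hn' : θ = θ₀ + n * (2 * π) := by
      have h3 : ((θ:ℂ)) * I = ((θ₀ + n * (2 * π) : ℝ) : ℂ) * I := by rw [hn]; push_cast; ring
      exact_mod_cast mul_right_cancel₀ I_ne_zero h3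
    have hpi := Real.pi_pos
    have h1 : (n:ℝ) < 1 := by
      by_contra hcon
      push Not at hcon
      nlinarith [hθ'.2, hθ.1]
    have h2 : (-1:ℝ) < n := by
      by_contra hcon
      push Not at hcon
      nlinarith [hθ'.1, hθ.2]
    have h1' : n < 1 := by exact_mod_cast h1
    have h2' : -1 < n := by exact_mod_cast h2
    have : n = 0 := by omega
    simpa [this] using hn'
  have hcpt : IsCompact (Set.Icc 0 (2 * π) \ ball θ₀ η) := isCompact_Icc.diff isOpen_ball
  obtain ⟨m, hm, hmb⟩ : ∃ m > 0, ∀ θ ∈ Set.Icc 0 (2 * π) \ ball θ₀ η,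
      m ≤ ‖Complex.exp (θ * I) - Complex.exp (θ₀ * I)‖ := by
    apply hcpt.exists_forall_le' (f := fun θ : ℝ => ‖Complex.exp (θ * I) - Complex.exp (θ₀ * I)‖)
      (a := 0) (by fun_prop)
    intro θ hθ'
    rw [norm_pos_iff, sub_ne_zero]
    intro h
    exact hθ'.2 (by rw [hinj θ hθ'.1 h]; exact mem_ball_self hη)
  have hB0 : 0 ≤ B := (norm_nonneg _).trans (hB θ₀ ⟨hθ.1.le, hθ.2.le⟩)
  refine ⟨(B + B + ‖c‖ * 2) / m ^ 3, by positivity, fun θ hθ' => ?_⟩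
  by_cases hball : θ ∈ ball θ₀ η
  · have := hnear (mem_ball.1 hball)
    refine this.trans (le_add_of_nonneg_right (by positivity))
  · have h1 := hmb θ ⟨hθ', hball⟩
    refine le_trans ?_ (le_add_of_nonneg_left (by positivity))
    have h2 : ‖g θ - g θ₀ - c * (Complex.exp (θ * I) - Complex.exp (θ₀ * I))‖
        ≤ B + B + ‖c‖ * 2 := by
      refine (norm_sub_le _ _).trans (add_le_add ((norm_sub_le _ _).trans
        (add_le_add (hB _ hθ') (hB _ ⟨hθ.1.le, hθ.2.le⟩))) ?_)
      rw [norm_mul]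
      gcongr
      refine (norm_sub_le _ _).trans ?_
      rw [norm_exp_ofReal_mul_I, norm_exp_ofReal_mul_I]; norm_num
    refine h2.trans ?_
    rw [div_mul_eq_mul_div, le_div_iff₀ (by positivity)]
    gcongr

lemma fatou_radial {F f : ℂ → ℂ} (hF : ∀ z ∈ ball (0:ℂ) 1, HasDerivAt F (f z) z)
    (hfc : ContinuousOn f (ball 0 1))
    {B : ℝ} (hB : ∀ r ∈ Set.Ico (0:ℝ) 1, ∀ θ ∈ Set.Icc 0 (2 * π), ‖F (r * Complex.exp (θ * I))‖ ≤ B)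
    {g : ℝ → ℂ} (hg : ∀ θ ∈ Set.Icc 0 (2 * π),
      Tendsto (fun r : ℝ => F (r * Complex.exp (θ * I))) (𝓝[<] 1) (𝓝 (g θ)))
    {θ₀ : ℝ} (hθ : θ₀ ∈ Set.Ioo 0 (2 * π)) {g' : ℂ} (hg' : HasDerivAt g g' θ₀) :
    Tendsto (fun r : ℝ => f (r * Complex.exp (θ₀ * I))) (𝓝[<] 1)
      (𝓝 (g' / (I * Complex.exp (θ₀ * I)))) := by
  set ζ₀ := Complex.exp (θ₀ * I) with hζ₀
  set c := g' / (I * ζ₀) with hc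
  have h0 : ‖ζ₀‖ = 1 := norm_exp_ofReal_mul_I _
  have hpi := Real.pi_pos
  have hIoo : ∀ᶠ r : ℝ in 𝓝[<] 1, r ∈ Set.Ioo (0:ℝ) 1 := Ioo_mem_nhdsLT one_pos
  have hgB : ∀ θ ∈ Set.Icc 0 (2 * π), ‖g θ‖ ≤ B := fun θ hθ => by
    refine le_of_tendsto (hg θ hθ).norm ?_
    filter_upwards [hIoo] with r hr using hB r ⟨hr.1.le, hr.2⟩ θ hθ
  -- the main estimate
  have main : ∀ ε > 0, ∃ A : ℝ, 0 ≤ A ∧ ∀ r ∈ Set.Ioo (0:ℝ) 1,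
      ‖f (r * ζ₀) - c‖ ≤ 4 * ε + 16 * A * (1 - r ^ 2) := by
    intro ε hε
    obtain ⟨A, hA, hAb⟩ := exp_bound hθ hg' hgB hε
    refine ⟨A, hA, fun r hr => ?_⟩
    -- s-level inequality
    have hs : ∀ s ∈ Set.Ioo (0:ℝ) 1, ‖s * f (s * (r * ζ₀)) - c‖ ≤ (2 * π)⁻¹ *
        ∫ θ in (0:ℝ)..2 * π, ‖kerK ζ₀ r (Complex.exp (θ * I))‖ *
          ‖F (s * Complex.exp (θ * I)) - g θ₀ - c * (Complex.exp (θ * I) - ζ₀)‖ := by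
      intro s hs
      set G : ℂ → ℂ := fun z => F (s * z) - g θ₀ - c * (z - ζ₀) with hG
      have hsmem : ∀ z ∈ ball (0:ℂ) (1 / s), (s * z : ℂ) ∈ ball (0:ℂ) 1 := by
        intro z hz
        have hz' : ‖z‖ < 1 / s := by simpa using hz
        rw [lt_div_iff₀ hs.1] at hz'
        simp [abs_of_pos hs.1]; linarith
      have hGd : ∀ z ∈ ball (0:ℂ) (1 / s), HasDerivAt G (s * f (s * z) - c) z := by
        intro z hz
        have h1 : HasDerivAt (fun z : ℂ => (s:ℂ) * z) ((s:ℂ) * 1) z := (hasDerivAt_id z).const_mul _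
        have h2 := (hF _ (hsmem z hz)).comp z h1
        have h3 : HasDerivAt (fun z : ℂ => c * (z - ζ₀)) (c * 1) z :=
          ((hasDerivAt_id z).sub_const _).const_mul c
        have := (h2.sub_const (g θ₀)).sub h3
        refine this.congr_deriv ?_
        ring
      have hs1 : 1 < 1 / s := by rw [lt_div_iff₀ hs.1]; linarith [hs.2]
      have hrep := kerK_repr h0 hr.1 hr.2 isOpen_ball (closedBall_subset_ball hs1)
        (fun z hz => (hGd z hz).differentiableAt.differentiableWithinAt)
      have hrm : (r * ζ₀ : ℂ) ∈ ball (0:ℂ) (1 / s) := by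
        simp only [mem_ball_zero_iff, norm_mul, h0, Complex.norm_real, Real.norm_eq_abs,
          abs_of_pos hr.1]
        linarith [hr.2]
      rw [(hGd _ hrm).deriv] at hrep
      rw [← hrep, norm_smul]
      have hn : ‖(2 * π * I : ℂ)⁻¹‖ = (2 * π)⁻¹ := by
        simp [abs_of_pos hpi]
      rw [hn]
      gcongr
      rw [circleIntegral]
      refine (intervalIntegral.norm_integral_le_integral_norm (by positivity)).trans (le_of_eq ?_)
      congr 1
      ext θ
      simp [circleMap, norm_smul, norm_exp_ofReal_mul_I, hG, deriv_circleMap]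
    have hk : ∃ C : ℝ, ∀ θ : ℝ, ‖kerK ζ₀ r (Complex.exp (θ * I))‖ ≤ C := by
      obtain ⟨C, hC⟩ := (isCompact_sphere (0:ℂ) 1).exists_bound_of_continuousOn
        (kerK_cont h0 hr.1 hr.2)
      exact ⟨C, fun θ => hC _ (by simp [norm_exp_ofReal_mul_I])⟩
    have hkc : Continuous (fun θ : ℝ => kerK ζ₀ r (Complex.exp (θ * I))) :=
      (kerK_cont h0 hr.1 hr.2).comp_continuous (by fun_prop)
        (fun θ => by simp [norm_exp_ofReal_mul_I])
    obtain ⟨C, hC⟩ := hk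
    have hlim : Tendsto (fun s : ℝ => ∫ θ in (0:ℝ)..2 * π, ‖kerK ζ₀ r (Complex.exp (θ * I))‖ *
          ‖F (s * Complex.exp (θ * I)) - g θ₀ - c * (Complex.exp (θ * I) - ζ₀)‖) (𝓝[<] 1)
        (𝓝 (∫ θ in (0:ℝ)..2 * π, ‖kerK ζ₀ r (Complex.exp (θ * I))‖ *
          ‖g θ - g θ₀ - c * (Complex.exp (θ * I) - ζ₀)‖)) := by
      refine intervalIntegral.tendsto_integral_filter_of_dominated_convergence
        (fun _ => C * (B + ‖g θ₀‖ + ‖c‖ * 2)) ?_ ?_ (by simp) ?_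
      · filter_upwards [hIoo] with s hs
        refine Continuous.aestronglyMeasurable ?_
        have : Continuous (fun θ : ℝ => F (s * Complex.exp (θ * I))) := by
          refine ContinuousOn.comp_continuous (s := ball (0:ℂ) 1)
            (fun z hz => (hF z hz).continuousAt.continuousWithinAt) (by fun_prop) ?_
          intro θ
          simp [norm_exp_ofReal_mul_I, abs_of_pos hs.1, hs.2]
        exact hkc.norm.mul ((this.sub continuous_const).sub (by fun_prop)).norm
      · filter_upwards [hIoo] with s hs
        refine Eventually.of_forall fun θ hθ' => ?_
        rw [Set.uIoc_of_le (by positivity)] at hθ'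
        rw [norm_mul, norm_norm, norm_norm]
        have hC0 : 0 ≤ C := (norm_nonneg _).trans (hC θ)
        refine mul_le_mul (hC θ) ?_ (norm_nonneg _) hC0
        refine (norm_sub_le _ _).trans (add_le_add ((norm_sub_le _ _).trans
          (add_le_add (hB s ⟨hs.1.le, hs.2⟩ θ ⟨hθ'.1.le, hθ'.2⟩) le_rfl)) ?_)
        rw [norm_mul]
        gcongr
        refine (norm_sub_le _ _).trans ?_
        rw [norm_exp_ofReal_mul_I, h0]; norm_num
      · refine Eventually.of_forall fun θ hθ' => ?_
        rw [Set.uIoc_of_le (by positivity)] at hθ'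
        exact ((((hg θ ⟨hθ'.1.le, hθ'.2⟩).sub_const _).sub_const _).norm).const_mul _
    have hlim0 : Tendsto (fun s : ℝ => ‖s * f (s * (r * ζ₀)) - c‖) (𝓝[<] 1)
        (𝓝 ‖f (r * ζ₀) - c‖) := by
      have hm : (r * ζ₀ : ℂ) ∈ ball (0:ℂ) 1 := by simp [h0, abs_of_pos hr.1, hr.2]
      have hca : ContinuousAt f (r * ζ₀) := hfc.continuousAt (isOpen_ball.mem_nhds hm)
      have h1 : Tendsto (fun s : ℝ => ((s:ℂ)) * (r * ζ₀)) (𝓝 1) (𝓝 (r * ζ₀)) := by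
        have : Continuous (fun s : ℝ => ((s:ℂ)) * (r * ζ₀)) := by fun_prop
        simpa using this.tendsto 1
      have h2 : Tendsto (fun s : ℝ => (s:ℂ)) (𝓝 1) (𝓝 1) := by
        simpa using (Complex.continuous_ofReal.tendsto 1)
      have h3 := h2.mul (hca.tendsto.comp h1)
      rw [one_mul] at h3
      exact ((h3.sub_const c).norm).mono_left nhdsWithin_le_nhds
    have hle : ‖f (r * ζ₀) - c‖ ≤ (2 * π)⁻¹ *
        ∫ θ in (0:ℝ)..2 * π, ‖kerK ζ₀ r (Complex.exp (θ * I))‖ *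
          ‖g θ - g θ₀ - c * (Complex.exp (θ * I) - ζ₀)‖ := by
      refine le_of_tendsto_of_tendsto hlim0 (hlim.const_mul _) ?_
      filter_upwards [hIoo] with s hs' using hs s hs'
    refine hle.trans ?_
    have hPc : Continuous (fun θ : ℝ => (1 - r ^ 2) / ‖Complex.exp (θ * I) - r * ζ₀‖ ^ 2) := by
      refine Continuous.div (by fun_prop) (by fun_prop) fun θ => ?_
      have := a_lower h0 (norm_exp_ofReal_mul_I θ) hr.1 hr.2
      have : 0 < ‖Complex.exp (θ * I) - r * ζ₀‖ := by linarith [hr.2]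
      positivity
    have hptw : ∀ θ ∈ Set.Icc 0 (2 * π), ‖kerK ζ₀ r (Complex.exp (θ * I))‖ *
          ‖g θ - g θ₀ - c * (Complex.exp (θ * I) - ζ₀)‖ ≤
        4 * ε * ((1 - r ^ 2) / ‖Complex.exp (θ * I) - r * ζ₀‖ ^ 2) + 16 * A * (1 - r ^ 2) := by
      intro θ hθ'
      obtain ⟨k1, k2⟩ := kerK_bound1 h0 (norm_exp_ofReal_mul_I θ) hr.1 hr.2
      calc _ ≤ ‖kerK ζ₀ r (Complex.exp (θ * I))‖ * (ε * ‖Complex.exp (θ * I) - ζ₀‖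
          + A * ‖Complex.exp (θ * I) - ζ₀‖ ^ 3) := by gcongr; exact hAb θ hθ'
        _ = ε * (‖kerK ζ₀ r (Complex.exp (θ * I))‖ * ‖Complex.exp (θ * I) - ζ₀‖)
          + A * (‖kerK ζ₀ r (Complex.exp (θ * I))‖ * ‖Complex.exp (θ * I) - ζ₀‖ ^ 3) := by ring
        _ ≤ ε * (4 * ((1 - r ^ 2) / ‖Complex.exp (θ * I) - r * ζ₀‖ ^ 2))
          + A * (16 * (1 - r ^ 2)) := by gcongr
        _ = _ := by ring
    have hint : ∫ θ in (0:ℝ)..2 * π, ‖kerK ζ₀ r (Complex.exp (θ * I))‖ *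
          ‖g θ - g θ₀ - c * (Complex.exp (θ * I) - ζ₀)‖ ≤
        ∫ θ in (0:ℝ)..2 * π, (4 * ε * ((1 - r ^ 2) / ‖Complex.exp (θ * I) - r * ζ₀‖ ^ 2)
          + 16 * A * (1 - r ^ 2)) := by
      rw [intervalIntegral.integral_of_le (by positivity),
        intervalIntegral.integral_of_le (by positivity)]
      refine integral_mono_of_nonneg (Eventually.of_forall fun θ => by positivity) ?_ ?_
      · have : Continuous (fun θ : ℝ => 4 * ε * ((1 - r ^ 2) / ‖Complex.exp (θ * I) - r * ζ₀‖ ^ 2)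
          + 16 * A * (1 - r ^ 2)) := by fun_prop
        exact (this.integrableOn_Icc).mono_set Set.Ioc_subset_Icc_self
      · refine (ae_restrict_iff' measurableSet_Ioc).2 (Eventually.of_forall fun θ hθ' => ?_)
        exact hptw θ ⟨hθ'.1.le, hθ'.2⟩
    rw [intervalIntegral.integral_add ((hPc.const_mul _).intervalIntegrable _ _) (by simp),
      intervalIntegral.integral_const_mul, poisson_mass h0 hr.1 hr.2] at hint
    simp only [intervalIntegral.integral_const, sub_zero, smul_eq_mul] at hint
    calc _ ≤ (2 * π)⁻¹ * (4 * ε * (2 * π) + 2 * π * (16 * A * (1 - r ^ 2))) := by gcongr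
      _ = _ := by field_simp
  rw [Metric.tendsto_nhds]
  intro ε hε
  obtain ⟨A, hA, hAb⟩ := main (ε / 8) (by positivity)
  have hl : Tendsto (fun r : ℝ => 4 * (ε / 8) + 16 * A * (1 - r ^ 2)) (𝓝[<] 1) (𝓝 (ε / 2)) := by
    have : Continuous (fun r : ℝ => 4 * (ε / 8) + 16 * A * (1 - r ^ 2)) := by fun_prop
    have h := this.tendsto 1
    have e : 4 * (ε / 8) + 16 * A * (1 - (1:ℝ) ^ 2) = ε / 2 := by ring
    rw [e] at h
    exact h.mono_left nhdsWithin_le_nhds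
  filter_upwards [hIoo, hl.eventually_lt_const (show ε / 2 < ε by linarith)] with r hr h2
  rw [dist_eq_norm]
  exact (hAb r hr).trans_lt h2


lemma le_radialTop (f : ℂ → ℂ) (θ : ℝ) {r : ℝ} (hr : r ∈ Set.Ico (0:ℝ) 1) :
    ‖f (r * Complex.exp (θ * I))‖ₑ ≤ radialLp ⊤ f θ := by
  unfold radialLp
  rw [if_pos rfl, ← ofReal_norm]
  exact le_iSup (fun r : Set.Ico (0:ℝ) 1 => ENNReal.ofReal ‖f ((r:ℝ) * Complex.exp (θ * I))‖) ⟨r, hr⟩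

lemma mem_ball_polar {r : ℝ} (hr : r ∈ Set.Ico (0:ℝ) 1) (θ : ℝ) :
    (r * Complex.exp (θ * I) : ℂ) ∈ ball (0:ℂ) 1 := by
  simp [norm_exp_ofReal_mul_I, abs_of_nonneg hr.1, hr.2]

lemma angular_est {F f : ℂ → ℂ} (hF : ∀ z ∈ ball (0:ℂ) 1, HasDerivAt F (f z) z)
    (hfc : ContinuousOn f (ball 0 1)) {r : ℝ} (hr : r ∈ Set.Ico (0:ℝ) 1) {a b : ℝ} (hab : a ≤ b) :
    edist (F (r * Complex.exp (a * I))) (F (r * Complex.exp (b * I)))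
      ≤ ∫⁻ θ in Set.Ioc a b, radialLp ⊤ f θ := by
  have hd : ∀ θ : ℝ, HasDerivAt (fun θ : ℝ => F (r * Complex.exp (θ * I)))
      (f (r * Complex.exp (θ * I)) * (r * (Complex.exp (θ * I) * (1 * I)))) θ := by
    intro θ
    have h1 : HasDerivAt (fun θ : ℝ => (θ:ℂ) * I) (1 * I) θ :=
      (Complex.ofRealCLM.hasDerivAt (x := θ)).mul_const I
    have h2 := h1.cexp.const_mul (r:ℂ)
    exact (hF _ (mem_ball_polar hr θ)).comp θ h2
  have hc : Continuous (fun θ : ℝ => f (r * Complex.exp (θ * I))) :=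
    hfc.comp_continuous (by fun_prop) (mem_ball_polar hr)
  have hI := intervalIntegral.integral_eq_sub_of_hasDerivAt (a := a) (b := b) (fun θ _ => hd θ)
    (Continuous.intervalIntegrable (hc.mul (by fun_prop)) _ _)
  rw [edist_comm, edist_eq_enorm_sub, ← hI, intervalIntegral.integral_of_le hab]
  refine (enorm_integral_le_lintegral_enorm _).trans (lintegral_mono fun θ => ?_)
  refine le_trans ?_ (le_radialTop f θ hr)
  rw [← ofReal_norm, ← ofReal_norm]
  apply ENNReal.ofReal_le_ofReal
  rw [norm_mul]
  refine mul_le_of_le_one_right (norm_nonneg _) ?_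
  simp [norm_exp_ofReal_mul_I, abs_of_nonneg hr.1, hr.2.le]

lemma radial_est {F f : ℂ → ℂ} (hF : ∀ z ∈ ball (0:ℂ) 1, HasDerivAt F (f z) z)
    {θ : ℝ} (hM : radialLp ⊤ f θ ≠ ⊤) {r r' : ℝ} (hr : r ∈ Set.Ico (0:ℝ) 1)
    (hr' : r' ∈ Set.Ico (0:ℝ) 1) :
    dist (F (r * Complex.exp (θ * I))) (F (r' * Complex.exp (θ * I)))
      ≤ (radialLp ⊤ f θ).toReal * |r - r'| := by
  rw [dist_eq_norm, ← Real.norm_eq_abs]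
  refine (convex_Ico (0:ℝ) 1).norm_image_sub_le_of_norm_hasDerivWithin_le
    (f := fun r : ℝ => F (r * Complex.exp (θ * I)))
    (f' := fun r : ℝ => f (r * Complex.exp (θ * I)) * (1 * Complex.exp (θ * I))) ?_ ?_ hr' hr
  · intro x hx
    have h1 : HasDerivAt (fun r : ℝ => (r:ℂ) * Complex.exp (θ * I)) (1 * Complex.exp (θ * I)) x :=
      (Complex.ofRealCLM.hasDerivAt (x := x)).mul_const _
    exact ((hF _ (mem_ball_polar hx θ)).comp x h1).hasDerivWithinAt
  · intro x hx
    rw [one_mul, norm_mul, norm_exp_ofReal_mul_I, mul_one]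
    have := ENNReal.toReal_mono hM (le_radialTop f θ hx)
    simpa using this

lemma radial_limit_ae {f : ℂ → ℂ} (hf : DifferentiableOn ℂ f (ball 0 1))
    (hmeas : Measurable (radialLp ⊤ f))
    (hM : ∫⁻ θ in Set.Ioc (0:ℝ) (2 * π), radialLp ⊤ f θ ≠ ⊤) :
    ∀ᵐ θ : ℝ, θ ∈ Set.Ioo 0 (2 * π) →
      ∃ c, Tendsto (fun r : ℝ => f (r * Complex.exp (θ * I))) (𝓝[<] 1) (𝓝 c) := by
  have hpi := Real.pi_pos
  obtain ⟨F, hF⟩ : IsExactOn f (ball 0 1) := hf.isExactOn_ball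
  have hfc := hf.continuousOn
  set M := radialLp ⊤ f with hMdef
  have hIoo : ∀ᶠ r : ℝ in 𝓝[<] 1, r ∈ Set.Ico (0:ℝ) 1 := Ico_mem_nhdsLT one_pos
  have hfin : ∀ᵐ θ : ℝ, θ ∈ Set.Ioc 0 (2 * π) → M θ < ⊤ := by
    rw [← ae_restrict_iff' measurableSet_Ioc]
    exact ae_lt_top hmeas hM
  -- good points
  have hgood : ∀ a b : ℝ, 0 ≤ a → a < b → b ≤ 2 * π → ∃ θ ∈ Set.Ioo a b, M θ < ⊤ := by
    intro a b ha hab hb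
    have h1 : ∃ᵐ θ : ℝ, θ ∈ Set.Ioo a b := by
      rw [frequently_ae_mem_iff]
      simp [hab]
    obtain ⟨θ, h2, h3⟩ := (h1.and_eventually hfin).exists
    exact ⟨θ, h2, h3 ⟨ha.trans_lt h2.1, h2.2.le.trans hb⟩⟩
  have hang : ∀ r ∈ Set.Ico (0:ℝ) 1, ∀ a b : ℝ,
      edist (F (r * Complex.exp (a * I))) (F (r * Complex.exp (b * I)))
      ≤ ∫⁻ θ in Set.uIoc a b, M θ := by
    intro r hr a b
    rcases le_total a b with h | h
    · rw [Set.uIoc_of_le h]; exact angular_est hF hfc hr h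
    · rw [Set.uIoc_of_ge h, edist_comm]; exact angular_est hF hfc hr h
  -- limits
  have hlim : ∀ θ ∈ Set.Icc 0 (2 * π), ∃ c,
      Tendsto (fun r : ℝ => F (r * Complex.exp (θ * I))) (𝓝[<] 1) (𝓝 c) := by
    intro θ hθ
    apply CompleteSpace.complete
    rw [EMetric.cauchy_iff]
    refine ⟨NeBot.ne (inferInstance : NeBot (map _ _)), fun ε hε => ?_⟩
    obtain ⟨δ, hδ, hδM⟩ := exists_pos_setLIntegral_lt_of_measure_lt hM
      (ε := ε / 4) (by simpa using hε.ne')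
    obtain ⟨δ', hδ', hδ2⟩ : ∃ δ' : ℝ, 0 < δ' ∧ ENNReal.ofReal δ' < δ := by
      obtain ⟨x, hx, hx2⟩ := ENNReal.lt_iff_exists_nnreal_btwn.1 hδ
      refine ⟨x, by exact_mod_cast hx, by simpa using hx2⟩
    have hex : ∃ θ' ∈ Set.Icc 0 (2 * π), |θ' - θ| < δ' ∧ M θ' < ⊤ := by
      rcases lt_or_ge θ (2 * π) with h | h
      · obtain ⟨x, hx, hx2⟩ := hgood θ (min (2 * π) (θ + δ')) hθ.1 (by simp [h, hδ'])
          (min_le_left _ _)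
        have := hx.2.trans_le (min_le_right _ _)
        have := hx.2.trans_le (min_le_left _ _)
        refine ⟨x, ⟨hθ.1.trans hx.1.le, this.le⟩, ?_, hx2⟩
        rw [abs_lt]; constructor <;> linarith [hx.1]
      · obtain ⟨x, hx, hx2⟩ := hgood (max 0 (θ - δ')) θ (le_max_left _ _)
          (by simp [hδ']; linarith) hθ.2
        have := (le_max_right _ _).trans_lt hx.1
        have := (le_max_left _ _).trans_lt hx.1
        refine ⟨x, ⟨this.le, hx.2.le.trans hθ.2⟩, ?_, hx2⟩
        rw [abs_lt]; constructor <;> linarith [hx.2]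
    obtain ⟨θ', hθ', hd, hMθ'⟩ := hex
    have hsmall : ∫⁻ x in Set.uIoc θ θ', M x < ε / 4 := by
      have h1 : volume.restrict (Set.Ioc (0:ℝ) (2 * π)) (Set.uIoc θ θ') < δ := by
        refine (Measure.restrict_apply_le _ _).trans_lt (lt_of_le_of_lt ?_ hδ2)
        rw [Set.uIoc, Real.volume_Ioc, max_sub_min_eq_abs]
        exact ENNReal.ofReal_le_ofReal hd.le
      have h2 := hδM _ h1
      rwa [Measure.restrict_restrict measurableSet_uIoc, Set.inter_eq_left.2] at h2
      intro x hx
      rw [Set.uIoc, Set.mem_Ioc] at hx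
      exact ⟨(le_min hθ.1 hθ'.1).trans_lt hx.1, hx.2.trans (max_le hθ.2 hθ'.2)⟩
    -- radial part at θ'
    have hc : Tendsto (fun r : ℝ => M θ' * ENNReal.ofReal (1 - r)) (𝓝[<] 1) (𝓝 0) := by
      have h1 : Tendsto (fun r : ℝ => ENNReal.ofReal (1 - r)) (𝓝[<] 1) (𝓝 0) := by
        have : Continuous (fun r : ℝ => ENNReal.ofReal (1 - r)) :=
          ENNReal.continuous_ofReal.comp (by fun_prop)
        have := this.tendsto 1
        simp only [sub_self, ENNReal.ofReal_zero] at this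
        exact this.mono_left nhdsWithin_le_nhds
      simpa using ENNReal.Tendsto.const_mul h1 (Or.inr hMθ'.ne)
    have hε4 : 0 < ε / 4 := by simpa using hε.ne'
    obtain ⟨S, hS, hSp⟩ := (hIoo.and (hc.eventually_lt_const hε4)).exists_mem
    refine ⟨_, image_mem_map hS, ?_⟩
    have hrr : ∀ r ∈ S, ∀ r' ∈ S, r ≤ r' → edist (F (r * Complex.exp (θ * I)))
        (F (r' * Complex.exp (θ * I))) < ε := by
      intro r hr r' hr' hle
      have h1 := hang r (hSp r hr).1 θ θ'
      have h2 := hang r' (hSp r' hr').1 θ θ'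
      have h3 : edist (F (r * Complex.exp (θ' * I))) (F (r' * Complex.exp (θ' * I))) < ε / 4 := by
        refine lt_of_le_of_lt ?_ (hSp r hr).2
        have := radial_est hF hMθ'.ne (hSp r hr).1 (hSp r' hr').1
        rw [edist_dist]
        refine (ENNReal.ofReal_le_ofReal this).trans ?_
        rw [ENNReal.ofReal_mul ENNReal.toReal_nonneg, ENNReal.ofReal_toReal hMθ'.ne]
        gcongr
        rw [abs_sub_comm, abs_of_nonneg (by linarith)]
        linarith [(hSp r' hr').1.2]
      have h4 := edist_triangle4 (F (r * Complex.exp (θ * I))) (F (r * Complex.exp (θ' * I)))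
        (F (r' * Complex.exp (θ' * I))) (F (r' * Complex.exp (θ * I)))
      rw [edist_comm (F (r' * Complex.exp (θ' * I)))] at h4
      refine h4.trans_lt ?_
      refine (ENNReal.add_lt_add (ENNReal.add_lt_add (h1.trans_lt hsmall) h3)
        (h2.trans_lt hsmall)).trans_le ?_
      calc ε / 4 + ε / 4 + ε / 4 ≤ ε / 4 + ε / 4 + ε / 4 + ε / 4 := le_self_add
        _ = ε := by
          have : ε / 4 + ε / 4 + ε / 4 + ε / 4 = ε / 4 * 4 := by ring
          rw [this, ENNReal.div_mul_cancel (by norm_num) (by norm_num)]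
    rintro _ ⟨r, hr, rfl⟩ _ ⟨r', hr', rfl⟩
    rcases le_total r r' with h | h
    · exact hrr r hr r' hr' h
    · rw [edist_comm]; exact hrr r' hr' r hr h
  choose! g hg using hlim
  -- boundedness
  obtain ⟨θ₁, hθ₁, hMθ₁⟩ := hgood 0 (2 * π) le_rfl (by positivity) le_rfl
  have hB : ∀ r ∈ Set.Ico (0:ℝ) 1, ∀ θ ∈ Set.Icc 0 (2 * π), ‖F (r * Complex.exp (θ * I))‖ ≤
      ‖F 0‖ + (M θ₁).toReal + (∫⁻ θ in Set.Ioc (0:ℝ) (2 * π), M θ).toReal := by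
    intro r hr θ hθ
    have h1 := radial_est hF hMθ₁.ne hr (r' := 0) (by simp)
    have h2 : edist (F (r * Complex.exp (θ * I))) (F (r * Complex.exp (θ₁ * I))) ≤
        ∫⁻ θ in Set.Ioc (0:ℝ) (2 * π), M θ := by
      refine (hang r hr θ θ₁).trans (lintegral_mono_set ?_)
      intro x hx
      rw [Set.uIoc, Set.mem_Ioc] at hx
      exact ⟨(le_min hθ.1 hθ₁.1.le).trans_lt hx.1, hx.2.trans (max_le hθ.2 hθ₁.2.le)⟩
    have h2' := ENNReal.toReal_mono hM h2
    rw [← dist_edist] at h2'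
    have h1' : dist (F (r * Complex.exp (θ₁ * I))) (F 0) ≤ (M θ₁).toReal := by
      have h3 : dist (F (r * Complex.exp (θ₁ * I))) (F 0) ≤ (M θ₁).toReal * |r| := by
        simpa using h1
      refine h3.trans (mul_le_of_le_one_right ENNReal.toReal_nonneg ?_)
      rw [abs_of_nonneg hr.1]; exact hr.2.le
    have h5 : ‖F (r * Complex.exp (θ * I))‖ ≤ ‖F 0‖ + dist (F (r * Complex.exp (θ * I))) (F 0) := by
      rw [dist_eq_norm]
      have := norm_add_le (F 0) (F (r * Complex.exp (θ * I)) - F 0)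
      simpa using this
    have := dist_triangle (F (r * Complex.exp (θ * I))) (F (r * Complex.exp (θ₁ * I))) (F 0)
    linarith
  -- bounded variation
  have hgd : ∀ a ∈ Set.Icc 0 (2 * π), ∀ b ∈ Set.Icc 0 (2 * π), a ≤ b →
      edist (g a) (g b) ≤ ∫⁻ θ in Set.Ioc a b, M θ := by
    intro a ha b hb hab
    refine le_of_tendsto ((hg a ha).edist (hg b hb)) ?_
    filter_upwards [hIoo] with r hr using angular_est hF hfc hr hab
  have hBV : BoundedVariationOn g (Set.uIcc 0 (2 * π)) := by
    refine ne_top_of_le_ne_top hM ?_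
    rw [Set.uIcc_of_le (by positivity)]
    refine iSup_le ?_
    rintro ⟨n, u, hu, hus⟩
    have hsum : ∀ n : ℕ, ∑ i ∈ Finset.range n, edist (g (u (i + 1))) (g (u i))
        ≤ ∫⁻ θ in Set.Ioc (u 0) (u n), M θ := by
      intro n
      induction n with
      | zero => simp
      | succ n ih =>
        rw [Finset.sum_range_succ]
        have hU : Set.Ioc (u 0) (u (n + 1)) = Set.Ioc (u 0) (u n) ∪ Set.Ioc (u n) (u (n + 1)) :=
          (Set.Ioc_union_Ioc_eq_Ioc (hu (Nat.zero_le n)) (hu (Nat.le_succ n))).symm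
        rw [hU, lintegral_union measurableSet_Ioc (Set.Ioc_disjoint_Ioc_of_le le_rfl)]
        refine add_le_add ih ?_
        rw [edist_comm]
        exact hgd _ (hus _) _ (hus _) (hu (Nat.le_succ n))
    refine (hsum n).trans (lintegral_mono_set ?_)
    exact Set.Ioc_subset_Ioc (hus 0).1 (hus n).2
  filter_upwards [hBV.ae_differentiableAt_of_mem_uIcc] with θ hθ hθ'
  have hd := hθ (by rw [Set.uIcc_of_le (by positivity)]; exact ⟨hθ'.1.le, hθ'.2.le⟩)
  exact ⟨_, fatou_radial hF hfc hB hg hθ' hd.hasDerivAt⟩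


lemma radialLp_eq {p : ℝ≥0∞} (hp0 : p ≠ 0) (hp : p ≠ ⊤) (g : ℂ → ℂ) (θ : ℝ) :
    radialLp p g θ = eLpNorm (fun r : ℝ => g (r * Complex.exp (θ * I))) p
      (volume.restrict (Set.Ioo (0:ℝ) 1)) := by
  unfold radialLp
  rw [if_neg hp, eLpNorm_eq_lintegral_rpow_enorm_toReal hp0 hp]
  congr 1
  refine lintegral_congr fun r => ?_
  rw [← ENNReal.ofReal_rpow_of_nonneg (norm_nonneg _) ENNReal.toReal_nonneg, ofReal_norm]

lemma ray_cont {g : ℂ → ℂ} (hg : ContinuousOn g (ball 0 1)) (θ : ℝ) :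
    ContinuousOn (fun r : ℝ => g (r * Complex.exp (θ * I))) (Set.Ico 0 1) :=
  hg.comp (by fun_prop) fun _ hr => mem_ball_polar hr θ

lemma ray_aesm {g : ℂ → ℂ} (hg : ContinuousOn g (ball 0 1)) (θ : ℝ) :
    AEStronglyMeasurable (fun r : ℝ => g (r * Complex.exp (θ * I)))
      (volume.restrict (Set.Ioo (0:ℝ) 1)) :=
  ((ray_cont hg θ).mono Set.Ioo_subset_Ico_self).aestronglyMeasurable measurableSet_Ioo

lemma radialLp_top_le {g : ℂ → ℂ} {θ : ℝ} {C : ℝ≥0∞}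
    (h : ∀ r ∈ Set.Ico (0:ℝ) 1, ‖g (r * Complex.exp (θ * I))‖ₑ ≤ C) : radialLp ⊤ g θ ≤ C := by
  unfold radialLp
  rw [if_pos rfl]
  refine iSup_le fun r => ?_
  rw [ofReal_norm]
  exact h r r.2

lemma radialLp_add {p : ℝ≥0∞} (hp : 1 ≤ p) {g h : ℂ → ℂ} (hg : ContinuousOn g (ball 0 1))
    (hh : ContinuousOn h (ball 0 1)) (θ : ℝ) :
    radialLp p (fun z => g z + h z) θ ≤ radialLp p g θ + radialLp p h θ := by
  by_cases hpt : p = ⊤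
  · subst hpt
    refine radialLp_top_le fun r hr => (enorm_add_le _ _).trans ?_
    exact add_le_add (le_radialTop g θ hr) (le_radialTop h θ hr)
  · have hp0 : p ≠ 0 := (zero_lt_one.trans_le hp).ne'
    rw [radialLp_eq hp0 hpt, radialLp_eq hp0 hpt, radialLp_eq hp0 hpt]
    exact eLpNorm_add_le (ray_aesm hg θ) (ray_aesm hh θ) hp

lemma radialLp_neg {p : ℝ≥0∞} {g : ℂ → ℂ} (θ : ℝ) :
    radialLp p (fun z => - g z) θ = radialLp p g θ := by
  unfold radialLp
  simp only [norm_neg]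

lemma radialLp_sub {p : ℝ≥0∞} (hp : 1 ≤ p) {g h : ℂ → ℂ} (hg : ContinuousOn g (ball 0 1))
    (hh : ContinuousOn h (ball 0 1)) (θ : ℝ) :
    radialLp p (fun z => g z - h z) θ ≤ radialLp p g θ + radialLp p h θ := by
  simp only [sub_eq_add_neg]
  rw [← radialLp_neg (g := h)]
  exact radialLp_add hp hg hh.neg θ

lemma radialLp_const {p : ℝ≥0∞} (hp : 1 ≤ p) {g : ℂ → ℂ} {ε : ℝ}
    (h : ∀ z ∈ ball (0:ℂ) 1, ‖g z‖ ≤ ε) (θ : ℝ) : radialLp p g θ ≤ ENNReal.ofReal ε := by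
  by_cases hpt : p = ⊤
  · subst hpt
    refine radialLp_top_le fun r hr => ?_
    rw [← ofReal_norm]
    exact ENNReal.ofReal_le_ofReal (h _ (mem_ball_polar hr θ))
  · have hp0 : p ≠ 0 := (zero_lt_one.trans_le hp).ne'
    rw [radialLp_eq hp0 hpt]
    refine (eLpNorm_le_of_ae_bound (C := ε) ?_).trans ?_
    · refine (ae_restrict_iff' measurableSet_Ioo).2 (Eventually.of_forall fun r hr => ?_)
      exact h _ (mem_ball_polar ⟨hr.1.le, hr.2⟩ θ)
    · simp

lemma dil_cont {f : ℂ → ℂ} (hf : ContinuousOn f (ball 0 1)) {s : ℝ} (hs : s ∈ Set.Ico (0:ℝ) 1) :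
    ContinuousOn (fun z => f (s * z)) (ball 0 1) := by
  refine hf.comp (by fun_prop) fun z hz => ?_
  have hz : ‖z‖ < 1 := by simpa using hz
  simp only [mem_ball_zero_iff, norm_mul, Complex.norm_real, Real.norm_eq_abs, abs_of_nonneg hs.1]
  nlinarith [norm_nonneg z, hs.1, hs.2]

lemma lintegral_dil (φ : ℝ → ℝ≥0∞) {s : ℝ} (hs : 0 < s) (hs1 : s < 1) :
    ∫⁻ r in Set.Ioo (0:ℝ) 1, φ (s * r) ≤ ENNReal.ofReal s⁻¹ * ∫⁻ r in Set.Ioo (0:ℝ) 1, φ r := by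
  have h1 : ∫⁻ r in Set.Ioo (0:ℝ) 1, φ (s * r) ≤
      ∫⁻ r, (Set.Ioo (0:ℝ) 1).indicator φ (s * r) := by
    rw [← lintegral_indicator measurableSet_Ioo]
    refine lintegral_mono fun r => ?_
    by_cases hr : r ∈ Set.Ioo (0:ℝ) 1
    · rw [Set.indicator_of_mem hr, Set.indicator_of_mem]
      exact ⟨mul_pos hs hr.1, by nlinarith [hr.1, hr.2]⟩
    · rw [Set.indicator_of_notMem hr]; exact zero_le
  refine h1.trans (le_of_eq ?_)
  have h2 := (Homeomorph.mulLeft₀ s hs.ne').measurableEmbedding.lintegral_map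
    ((Set.Ioo (0:ℝ) 1).indicator φ) (μ := volume)
  simp only [Homeomorph.coe_mulLeft₀] at h2
  rw [← h2, Real.map_volume_mul_left hs.ne', lintegral_smul_measure,
    lintegral_indicator measurableSet_Ioo, abs_of_pos (by positivity), smul_eq_mul]

lemma radialLp_dil {p : ℝ≥0∞} (hp : 1 ≤ p) (f : ℂ → ℂ) {s : ℝ} (hs : 1 / 2 ≤ s) (hs1 : s < 1)
    (θ : ℝ) : radialLp p (fun z => f (s * z)) θ ≤ 2 * radialLp p f θ := by
  by_cases hpt : p = ⊤
  · subst hpt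
    refine radialLp_top_le fun r hr => ?_
    have : (s * r : ℝ) ∈ Set.Ico (0:ℝ) 1 :=
      ⟨mul_nonneg (by linarith) hr.1, by nlinarith [hr.1, hr.2]⟩
    have h := le_radialTop f θ this
    rw [Complex.ofReal_mul, mul_assoc] at h
    refine h.trans ?_
    rw [two_mul]; exact le_self_add
  · have hp0 : p ≠ 0 := (zero_lt_one.trans_le hp).ne'
    have hp1 : 1 ≤ p.toReal := by
      have := ENNReal.toReal_mono hpt hp
      simpa using this
    unfold radialLp
    rw [if_neg hpt, if_neg hpt]
    have h := lintegral_dil (fun r : ℝ => ENNReal.ofReal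
          (‖f ((r : ℝ) * Complex.exp ((θ : ℂ) * Complex.I))‖ ^ p.toReal)) (by linarith) hs1
    have h2 : ENNReal.ofReal s⁻¹ ≤ 2 := by
      rw [← ENNReal.ofReal_ofNat]
      apply ENNReal.ofReal_le_ofReal
      rw [inv_le_comm₀ (by linarith) (by norm_num)]
      linarith
    simp only [Complex.ofReal_mul, mul_assoc] at h
    calc _ ≤ (2 * _) ^ (1 / p.toReal) :=
          ENNReal.rpow_le_rpow (h.trans (mul_le_mul_left h2 _)) (by positivity)
      _ = 2 ^ (1 / p.toReal) * _ := ENNReal.mul_rpow_of_nonneg _ _ (by positivity)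
      _ ≤ 2 ^ (1:ℝ) * _ := by
          gcongr
          · norm_num
          · rw [div_le_one (by linarith)]; exact hp1
      _ = _ := by rw [ENNReal.rpow_one]

lemma radialLp_meas (p : ℝ≥0∞) {g : ℂ → ℂ} (hg : ContinuousOn g (ball 0 1)) :
    Measurable (radialLp p g) := by
  by_cases hpt : p = ⊤
  · subst hpt
    have : LowerSemicontinuous (radialLp ⊤ g) := by
      unfold radialLp
      simp only [if_pos]
      refine lowerSemicontinuous_iSup fun r => Continuous.lowerSemicontinuous ?_
      refine ENNReal.continuous_ofReal.comp (Continuous.norm ?_)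
      exact hg.comp_continuous (by fun_prop) fun θ => mem_ball_polar r.2 θ
    exact this.measurable
  · set g' : ℂ → ℂ := (ball (0:ℂ) 1).indicator g with hg'
    have hgm : Measurable g' := by
      classical
      have : Measurable ((ball (0:ℂ) 1).piecewise g 0) :=
        hg.measurable_piecewise continuousOn_const measurableSet_ball
      rwa [Set.piecewise_eq_indicator] at this
    have heq : radialLp p g = fun θ : ℝ => (∫⁻ r in Set.Ioo (0:ℝ) 1, ENNReal.ofReal
          (‖g' ((r : ℝ) * Complex.exp ((θ : ℂ) * Complex.I))‖ ^ p.toReal)) ^ (1 / p.toReal) := by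
      ext θ
      unfold radialLp
      rw [if_neg hpt]
      congr 1
      refine setLIntegral_congr_fun measurableSet_Ioo fun r hr => ?_
      simp only [hg']
      rw [Set.indicator_of_mem (mem_ball_polar ⟨hr.1.le, hr.2⟩ θ)]
    rw [heq]
    refine Measurable.pow_const ?_ _
    refine Measurable.lintegral_prod_right' (f := fun x : ℝ × ℝ => ENNReal.ofReal
          (‖g' ((x.2 : ℝ) * Complex.exp ((x.1 : ℂ) * Complex.I))‖ ^ p.toReal)) ?_
    refine Measurable.ennreal_ofReal (Measurable.pow_const (Measurable.norm ?_) _)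
    exact hgm.comp (by fun_prop)

lemma top_tendsto {f : ℂ → ℂ} (hf : ContinuousOn f (ball 0 1)) {θ : ℝ} {c : ℂ}
    (hc : Tendsto (fun r : ℝ => f (r * Complex.exp (θ * I))) (𝓝[<] 1) (𝓝 c))
    {s : ℕ → ℝ} (hs : ∀ n, s n ∈ Set.Ico (1/2:ℝ) 1) (hs1 : Tendsto s atTop (𝓝 1)) :
    Tendsto (fun n => radialLp ⊤ (fun z => f z - f (s n * z)) θ) atTop (𝓝 0) := by
  set φ : ℝ → ℂ := fun r => f (r * Complex.exp (θ * I)) with hφ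
  set γ : ℝ → ℂ := Function.update φ 1 c with hγ
  have hγφ : ∀ r ∈ Set.Ico (0:ℝ) 1, γ r = φ r := fun r hr => by
    rw [hγ, Function.update_of_ne hr.2.ne]
  have hIcc : Set.Icc (0:ℝ) 1 \ {1} = Set.Ico 0 1 := by
    ext x; simp only [Set.mem_diff, Set.mem_Icc, Set.mem_singleton_iff, Set.mem_Ico]; grind
  have hγc : ContinuousOn γ (Set.Icc 0 1) := by
    rw [hγ, continuousOn_update_iff]
    refine ⟨?_, fun _ => ?_⟩
    · rw [hIcc]; exact ray_cont hf θ
    · rw [hIcc]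
      exact hc.mono_left (nhdsWithin_mono _ fun x hx => hx.2)
  have hu := isCompact_Icc.uniformContinuousOn_of_continuous hγc
  rw [Metric.uniformContinuousOn_iff] at hu
  rw [ENNReal.tendsto_nhds_zero]
  intro ε hε
  obtain ⟨x, hx, hx2⟩ := ENNReal.lt_iff_exists_nnreal_btwn.1 hε
  obtain ⟨δ, hδ, hδ2⟩ := hu x (by exact_mod_cast hx)
  filter_upwards [hs1.eventually (lt_mem_nhds (show 1 - δ < 1 by linarith))] with n hn
  refine radialLp_top_le fun r hr => ?_
  have hsr : s n * r ∈ Set.Ico (0:ℝ) 1 :=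
    ⟨mul_nonneg (by linarith [(hs n).1]) hr.1, by nlinarith [hr.1, hr.2, (hs n).2]⟩
  have h := hδ2 r ⟨hr.1, hr.2.le⟩ (s n * r) ⟨hsr.1, hsr.2.le⟩ (by
    rw [Real.dist_eq, abs_of_nonneg (by nlinarith [hr.1, (hs n).2])]
    nlinarith [hr.1, hr.2, (hs n).2])
  rw [hγφ _ hr, hγφ _ hsr, dist_eq_norm] at h
  refine le_trans ?_ hx2.le
  rw [← ofReal_norm, ← ENNReal.ofReal_coe_nnreal]
  apply ENNReal.ofReal_le_ofReal
  simp only [hφ, Complex.ofReal_mul, mul_assoc] at h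
  exact h.le


lemma eLpNorm_dil {p : ℝ≥0∞} (hp : 1 ≤ p) (hpt : p ≠ ⊤) (u : ℝ → ℂ) {s : ℝ} (hs : 1 / 2 ≤ s)
    (hs1 : s < 1) :
    eLpNorm (fun r => u (s * r)) p (volume.restrict (Set.Ioo (0:ℝ) 1)) ≤
      2 * eLpNorm u p (volume.restrict (Set.Ioo (0:ℝ) 1)) := by
  have hp0 : p ≠ 0 := (zero_lt_one.trans_le hp).ne'
  have hp1 : 1 ≤ p.toReal := by
    have := ENNReal.toReal_mono hpt hp
    simpa using this
  rw [eLpNorm_eq_lintegral_rpow_enorm_toReal hp0 hpt, eLpNorm_eq_lintegral_rpow_enorm_toReal hp0 hpt]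
  have h := lintegral_dil (fun r : ℝ => ‖u r‖ₑ ^ p.toReal) (by linarith) hs1
  have h2 : ENNReal.ofReal s⁻¹ ≤ 2 := by
    rw [← ENNReal.ofReal_ofNat]
    apply ENNReal.ofReal_le_ofReal
    rw [inv_le_comm₀ (by linarith) (by norm_num)]
    linarith
  calc _ ≤ (2 * _) ^ (1 / p.toReal) :=
        ENNReal.rpow_le_rpow (h.trans (mul_le_mul_left h2 _)) (by positivity)
    _ = 2 ^ (1 / p.toReal) * _ := ENNReal.mul_rpow_of_nonneg _ _ (by positivity)
    _ ≤ 2 ^ (1:ℝ) * _ := by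
        gcongr
        · norm_num
        · rw [div_le_one (by linarith)]; exact hp1
    _ = _ := by rw [ENNReal.rpow_one]

lemma fin_tendsto {p : ℝ≥0∞} (hp : 1 ≤ p) (hpt : p ≠ ⊤) {f : ℂ → ℂ}
    (hf : ContinuousOn f (ball 0 1)) {θ : ℝ} (hfin : radialLp p f θ ≠ ⊤)
    {s : ℕ → ℝ} (hs : ∀ n, s n ∈ Set.Ico (1/2:ℝ) 1) (hs1 : Tendsto s atTop (𝓝 1)) :
    Tendsto (fun n => radialLp p (fun z => f z - f (s n * z)) θ) atTop (𝓝 0) := by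
  have hp0 : p ≠ 0 := (zero_lt_one.trans_le hp).ne'
  set μ := volume.restrict (Set.Ioo (0:ℝ) 1) with hμ
  set φ : ℝ → ℂ := fun r => f (r * Complex.exp (θ * I)) with hφ
  have hmem : MemLp φ p μ := ⟨ray_aesm hf θ, by
    rw [← radialLp_eq hp0 hpt]; exact hfin.lt_top⟩
  rw [ENNReal.tendsto_nhds_zero]
  intro ε hε
  obtain ⟨x, hx, hx2⟩ := ENNReal.lt_iff_exists_nnreal_btwn.1 (ENNReal.div_pos hε.ne' (by norm_num : (4:ℝ≥0∞) ≠ ⊤))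
  obtain ⟨h, hsupp, hle, hcont, hmemh⟩ := hmem.exists_hasCompactSupport_eLpNorm_sub_le hpt hx.ne'
  have hu := (isCompact_Icc (a := (0:ℝ)) (b := 1)).uniformContinuousOn_of_continuous
    hcont.continuousOn
  rw [Metric.uniformContinuousOn_iff] at hu
  obtain ⟨δ, hδ, hδ2⟩ := hu x (by exact_mod_cast hx)
  filter_upwards [hs1.eventually (lt_mem_nhds (show 1 - δ < 1 by linarith))] with n hn
  rw [radialLp_eq hp0 hpt]
  have hmid : eLpNorm (fun r => h r - h (s n * r)) p μ ≤ x := by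
    refine (eLpNorm_le_of_ae_bound (C := (x:ℝ)) ?_).trans ?_
    · refine (ae_restrict_iff' measurableSet_Ioo).2 (Eventually.of_forall fun r hr => ?_)
      have := hδ2 r ⟨hr.1.le, hr.2.le⟩ (s n * r)
        ⟨mul_nonneg (by linarith [(hs n).1]) hr.1.le, by nlinarith [hr.1, hr.2, (hs n).2]⟩ (by
        rw [Real.dist_eq, abs_of_nonneg (by nlinarith [hr.1, (hs n).2])]
        nlinarith [hr.1, hr.2, (hs n).2])
      rw [dist_eq_norm] at this
      exact this.le
    · simp [hμ]
  have hlast : eLpNorm (fun r => (φ - h) (s n * r)) p μ ≤ 2 * x :=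
    (eLpNorm_dil hp hpt _ (hs n).1 (hs n).2).trans (by gcongr)
  have hsm1 : AEStronglyMeasurable (fun r => φ r - h r) μ := hmem.1.sub hmemh.1
  have hsm2 : AEStronglyMeasurable (fun r => h r - h (s n * r)) μ :=
    Continuous.aestronglyMeasurable (by fun_prop)
  have hsm3 : AEStronglyMeasurable (fun r => (φ - h) (s n * r)) μ := by
    have h1 : AEStronglyMeasurable (fun r => φ (s n * r)) μ := by
      have := ray_aesm (dil_cont hf (s := s n) ⟨by linarith [(hs n).1], (hs n).2⟩) θ
      simpa only [hφ, Complex.ofReal_mul, mul_assoc] using this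
    exact h1.sub (Continuous.aestronglyMeasurable (f := fun r => h (s n * r)) (by fun_prop))
  have heq : (fun r : ℝ => f (r * Complex.exp (θ * I)) - f (s n * (r * Complex.exp (θ * I)))) =
      ((fun r => φ r - h r) + (fun r => h r - h (s n * r))) + - (fun r => (φ - h) (s n * r)) := by
    ext r
    simp only [hφ, Pi.add_apply, Pi.neg_apply, Pi.sub_apply, Complex.ofReal_mul, mul_assoc]
    ring
  rw [heq]
  refine (eLpNorm_add_le (hsm1.add hsm2) hsm3.neg hp).trans ?_
  rw [eLpNorm_neg]
  refine (add_le_add (eLpNorm_add_le hsm1 hsm2 hp) le_rfl).trans ?_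
  calc _ ≤ (x:ℝ≥0∞) + x + 2 * x := add_le_add (add_le_add hle hmid) hlast
    _ = 4 * x := by ring
    _ ≤ 4 * (ε / 4) := by gcongr
    _ ≤ ε := ENNReal.mul_div_le

lemma poly_approx {f : ℂ → ℂ} (hf : DifferentiableOn ℂ f (ball 0 1)) {s : ℝ}
    (hs : s ∈ Set.Ico (1/2:ℝ) 1) {ε : ℝ} (hε : 0 < ε) :
    ∃ P : Polynomial ℂ, ∀ z ∈ ball (0:ℂ) 1, ‖f (s * z) - P.eval z‖ ≤ ε := by
  have hs0 : 0 < s := by linarith [hs.1]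
  obtain ⟨R, hsR, hR1⟩ := exists_between hs.2
  lift R to NNReal using by linarith
  lift s to NNReal using hs0.le
  have hR0 : (0:ℝ) < R := by linarith
  have hser := DifferentiableOn.hasFPowerSeriesOnBall (c := 0) (R := R) (f := f)
    (hf.mono (closedBall_subset_ball hR1)) (by exact_mod_cast hR0)
  have hun := hser.tendstoUniformlyOn (r' := s) (by exact_mod_cast hsR)
  rw [Metric.tendstoUniformlyOn_iff] at hun
  obtain ⟨n, hn⟩ := (hun ε hε).exists
  set a := cauchyPowerSeries f 0 R
  refine ⟨∑ k ∈ Finset.range n, Polynomial.C (a.coeff k * (s:ℂ) ^ k) * Polynomial.X ^ k, ?_⟩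
  intro z hz
  have hz : ‖z‖ < 1 := by simpa using hz
  have h := hn ((s:ℝ) * z) (by
    simp only [mem_ball_zero_iff, norm_mul, Complex.norm_real, Real.norm_eq_abs, abs_of_pos hs0]
    nlinarith)
  rw [dist_eq_norm, zero_add] at h
  refine le_of_eq_of_le ?_ h.le
  congr 2
  rw [FormalMultilinearSeries.partialSum, Polynomial.eval_finsetSum]
  refine Finset.sum_congr rfl fun k _ => ?_
  rw [FormalMultilinearSeries.apply_eq_pow_smul_coeff]
  simp [mul_pow]
  ring


lemma main_dense (p : ℝ≥0∞) (q : ℝ) (hp : 1 ≤ p) (hq : 1 ≤ q)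
    (f : ℂ → ℂ) (hf : DifferentiableOn ℂ f (ball (0 : ℂ) 1))
    (hfin : rhoE p (ENNReal.ofReal q) f ≠ ⊤) :
    ∀ ε : ℝ, 0 < ε → ∃ P : Polynomial ℂ,
      rhoE p (ENNReal.ofReal q) (fun z => f z - P.eval z) < ENNReal.ofReal ε := by
  have hq0 : 0 < q := by linarith
  have hfc := hf.continuousOn
  have hrho : ∀ g, rhoE p (ENNReal.ofReal q) g = ((ENNReal.ofReal (2 * Real.pi))⁻¹ *
        ∫⁻ θ in Set.Ioo (0 : ℝ) (2 * Real.pi), (radialLp p g θ) ^ q) ^ (1 / q) := by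
    intro g
    unfold rhoE
    rw [if_neg ENNReal.ofReal_ne_top, ENNReal.toReal_ofReal hq0.le]
  have hc0 : (ENNReal.ofReal (2 * Real.pi))⁻¹ ≠ 0 := ENNReal.inv_ne_zero.2 ENNReal.ofReal_ne_top
  have hct : (ENNReal.ofReal (2 * Real.pi))⁻¹ ≠ ⊤ := by
    rw [ENNReal.inv_ne_top]
    have := Real.pi_pos
    simp [this]
  set μ := volume.restrict (Set.Ioo (0 : ℝ) (2 * Real.pi)) with hμ
  have hfq : ∫⁻ θ, (radialLp p f θ) ^ q ∂μ ≠ ⊤ := by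
    intro h
    apply hfin
    rw [hrho, h, ENNReal.mul_top hc0, ENNReal.top_rpow_of_pos (by positivity)]
  have hmeas := radialLp_meas p hfc
  have hae : ∀ᵐ θ ∂μ, radialLp p f θ ≠ ⊤ := by
    filter_upwards [ae_lt_top (hmeas.pow_const q) hfq] with θ hθ h
    rw [h, ENNReal.top_rpow_of_pos hq0] at hθ
    exact lt_irrefl _ hθ
  have : IsFiniteMeasure μ := by rw [hμ]; infer_instance
  set s : ℕ → ℝ := fun n => 1 - 1 / ((n:ℝ) + 2) with hsdef
  have hs : ∀ n, s n ∈ Set.Ico (1/2:ℝ) 1 := by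
    intro n
    have hn : (0:ℝ) ≤ n := Nat.cast_nonneg n
    have h1 : 1 / ((n:ℝ) + 2) ≤ 1 / 2 := by
      apply one_div_le_one_div_of_le <;> linarith
    have h2 : 0 < 1 / ((n:ℝ) + 2) := by positivity
    simp only [hsdef, Set.mem_Ico]
    constructor <;> linarith
  have hs1 : Tendsto s atTop (𝓝 1) := by
    have h1 : Tendsto (fun n : ℕ => 1 / ((n:ℝ) + 2)) atTop (𝓝 0) := by
      have := (tendsto_one_div_add_atTop_nhds_zero_nat (𝕜 := ℝ)).comp (tendsto_add_atTop_nat 1)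
      refine this.congr fun n => ?_
      simp only [Function.comp_apply]
      push_cast
      ring_nf
    have h2 := h1.const_sub 1
    rwa [sub_zero] at h2
  have hpt : ∀ᵐ θ ∂μ, Tendsto (fun n => radialLp p (fun z => f z - f (s n * z)) θ) atTop (𝓝 0) := by
    by_cases hp' : p = ⊤
    · subst hp'
      have hint : ∫⁻ θ in Set.Ioc (0:ℝ) (2 * Real.pi), radialLp ⊤ f θ ≠ ⊤ := by
        rw [← restrict_Ioo_eq_restrict_Ioc, ← hμ]
        have hle : ∫⁻ θ, radialLp ⊤ f θ ∂μ ≤ ∫⁻ θ, (1 + (radialLp ⊤ f θ) ^ q) ∂μ := by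
          refine lintegral_mono fun θ => ?_
          rcases le_total (radialLp ⊤ f θ) 1 with h | h
          · exact h.trans le_self_add
          · refine le_trans ?_ le_add_self
            calc radialLp ⊤ f θ = radialLp ⊤ f θ ^ (1:ℝ) := (ENNReal.rpow_one _).symm
              _ ≤ _ := ENNReal.rpow_le_rpow_of_exponent_le h hq
        refine ne_top_of_le_ne_top ?_ hle
        rw [lintegral_add_left measurable_const, lintegral_const]
        exact ENNReal.add_ne_top.2 ⟨ENNReal.mul_ne_top (by simp) (measure_ne_top _ _), hfq⟩
      have h := radial_limit_ae hf hmeas hint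
      rw [hμ, ae_restrict_iff' measurableSet_Ioo]
      filter_upwards [h] with θ hθ hmem
      obtain ⟨c, hc⟩ := hθ hmem
      exact top_tendsto hfc hc hs hs1
    · filter_upwards [hae] with θ hθ
      exact fin_tendsto hp hp' hfc hθ hs hs1
  have hP : ∀ n : ℕ, ∃ P : Polynomial ℂ, ∀ z ∈ ball (0:ℂ) 1,
      ‖f (s n * z) - P.eval z‖ ≤ 1 / ((n:ℝ) + 1) := fun n => poly_approx hf (hs n) (by positivity)
  choose P hP using hP
  have hs' : ∀ n, s n ∈ Set.Ico (0:ℝ) 1 := fun n => ⟨by linarith [(hs n).1], (hs n).2⟩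
  have hPc : ∀ n, ContinuousOn (fun z => (P n).eval z) (ball (0:ℂ) 1) :=
    fun n => (P n).continuous.continuousOn
  have hdc := fun n => dil_cont hfc (hs' n)
  have hbd : ∀ n θ, radialLp p (fun z => f z - (P n).eval z) θ ≤
      radialLp p (fun z => f z - f (s n * z)) θ + ENNReal.ofReal (1 / ((n:ℝ) + 1)) := by
    intro n θ
    have h := radialLp_add hp (hfc.sub (hdc n)) ((hdc n).sub (hPc n)) θ
    simp only [Pi.sub_apply, sub_add_sub_cancel] at h
    exact h.trans (add_le_add le_rfl (radialLp_const hp (hP n) θ))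
  have hbd2 : ∀ n θ, radialLp p (fun z => f z - (P n).eval z) θ ≤ 3 * radialLp p f θ + 1 := by
    intro n θ
    refine (hbd n θ).trans (add_le_add ?_ ?_)
    · refine (radialLp_sub hp hfc (hdc n) θ).trans ?_
      refine (add_le_add le_rfl (radialLp_dil hp f (hs n).1 (hs n).2 θ)).trans ?_
      exact le_of_eq (by ring)
    · rw [← ENNReal.ofReal_one]
      apply ENNReal.ofReal_le_ofReal
      rw [div_le_one (by positivity)]
      linarith [(Nat.cast_nonneg n : (0:ℝ) ≤ n)]
  have h0 : Tendsto (fun n : ℕ => ENNReal.ofReal (1 / ((n:ℝ) + 1))) atTop (𝓝 0) := by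
    have := ENNReal.tendsto_ofReal (tendsto_one_div_add_atTop_nhds_zero_nat (𝕜 := ℝ))
    simpa using this
  have hlim : Tendsto (fun n => ∫⁻ θ, (radialLp p (fun z => f z - (P n).eval z) θ) ^ q ∂μ)
      atTop (𝓝 (∫⁻ _, 0 ∂μ)) := by
    refine tendsto_lintegral_of_dominated_convergence
      (fun θ => (3 * radialLp p f θ + 1) ^ q) ?_ ?_ ?_ ?_
    · intro n
      exact (radialLp_meas p (hfc.sub (hPc n))).pow_const q
    · intro n
      exact Eventually.of_forall fun θ => ENNReal.rpow_le_rpow (hbd2 n θ) hq0.le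
    · have hle : ∫⁻ θ, (3 * radialLp p f θ + 1) ^ q ∂μ ≤
          ∫⁻ θ, (2:ℝ≥0∞) ^ (q - 1) * ((3:ℝ≥0∞) ^ q * (radialLp p f θ) ^ q + 1) ∂μ := by
        refine lintegral_mono fun θ => ?_
        have := ENNReal.rpow_add_le_mul_rpow_add_rpow (3 * radialLp p f θ) 1 hq
        rwa [ENNReal.mul_rpow_of_nonneg _ _ hq0.le, ENNReal.one_rpow] at this
      refine ne_top_of_le_ne_top ?_ hle
      have h2 : (2:ℝ≥0∞) ^ (q - 1) ≠ ⊤ := ENNReal.rpow_ne_top_of_nonneg (by linarith) (by norm_num)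
      have h3 : (3:ℝ≥0∞) ^ q ≠ ⊤ := ENNReal.rpow_ne_top_of_nonneg (by linarith) (by norm_num)
      rw [lintegral_const_mul' _ _ h2, lintegral_add_right _ measurable_const,
        lintegral_const_mul' _ _ h3, lintegral_const]
      exact ENNReal.mul_ne_top h2 (ENNReal.add_ne_top.2 ⟨ENNReal.mul_ne_top h3 hfq,
        ENNReal.mul_ne_top (by simp) (measure_ne_top _ _)⟩)
    · filter_upwards [hpt] with θ hθ
      have h1 : Tendsto (fun n => radialLp p (fun z => f z - (P n).eval z) θ) atTop (𝓝 0) := by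
        refine tendsto_of_tendsto_of_tendsto_of_le_of_le tendsto_const_nhds
          (by simpa using hθ.add h0) (fun n => zero_le) (fun n => hbd n θ)
      have h2 := ((ENNReal.continuous_rpow_const (y := q)).tendsto 0).comp h1
      rwa [ENNReal.zero_rpow_of_pos hq0] at h2
  rw [lintegral_zero] at hlim
  have hfinal : Tendsto (fun n => rhoE p (ENNReal.ofReal q) (fun z => f z - (P n).eval z))
      atTop (𝓝 0) := by
    simp only [hrho]
    have h1 := ENNReal.Tendsto.const_mul (a := (ENNReal.ofReal (2 * Real.pi))⁻¹) hlim (Or.inr hct)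
    rw [mul_zero] at h1
    have h2 := ((ENNReal.continuous_rpow_const (y := 1 / q)).tendsto 0).comp h1
    rwa [ENNReal.zero_rpow_of_pos (by positivity)] at h2
  intro ε hε
  obtain ⟨n, hn⟩ := (hfinal.eventually (gt_mem_nhds (ENNReal.ofReal_pos.2 hε))).exists
  exact ⟨P n, hn⟩


end Helpers

/-- For `1 ≤ p ≤ ∞` and `1 ≤ q < ∞`, polynomials are dense in `RM(p,q)`;
in particular `RM(p,q)` is separable. -/
theorem stmt_13 (p : ℝ≥0∞) (q : ℝ) (hp : 1 ≤ p) (hq : 1 ≤ q)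
    (f : ℂ → ℂ) (hf : DifferentiableOn ℂ f (Metric.ball (0 : ℂ) 1))
    (hfin : rhoE p (ENNReal.ofReal q) f ≠ ⊤) :
    ∀ ε : ℝ, 0 < ε → ∃ P : Polynomial ℂ,
      rhoE p (ENNReal.ofReal q) (fun z => f z - P.eval z) < ENNReal.ofReal ε := by
  exact main_dense p q hp hq f hf hfin
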